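/- A packetized work-conserving FIFO server of constant bit rate c offers the service curve β(t) = c·max(t − l^M/c, 0), where l^M is the maximum packet length. Concretely: let c > 0, let packets n = 1, 2, ... arrive at times 0 ≤ a(1) ≤ a(2) ≤ ... with lengths 0 < l(n) ≤ l^M, and let departures satisfy d(0) = 0 and d(n) = max(a(n), d(n − 1)) + l(n)/c; let A(t) = Σ_{n : a(n) < t} l(n) and A*(t) = Σ_{n : d(n) < t} l(n). Then for all t ≥ 0, A*(t) ≥ inf_{0 ≤ s ≤ t} { A(s) + c·max(t − s − l^M/c, 0) }. -/

import Mathlib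

/-- Departure times of a packetized work-conserving FIFO server of constant bit
rate `c`: `d(0) = 0` and `d(n+1) = max(a(n+1), d(n)) + l(n+1)/c`, where `a` gives
the times the packets become available and `len` their lengths. -/
noncomputable def dep (c : ℝ) (a len : ℕ → ℝ) : ℕ → ℝ
  | 0 => 0
  | n + 1 => max (a (n + 1)) (dep c a len n) + len (n + 1) / c

theorem dep_monotone {c : ℝ} (hc : 0 < c) {a len : ℕ → ℝ} (hlen : ∀ n, 0 ≤ len n) :
    Monotone (dep c a len) := by
  refine monotone_nat_of_le_succ fun n => ?_
  have h1 := le_max_right (a (n + 1)) (dep c a len n)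
  have h2 := div_nonneg (hlen (n + 1)) hc.le
  simp only [dep]
  linarith

theorem arrival_le_dep {c : ℝ} (hc : 0 < c) {a len : ℕ → ℝ} (hlen : ∀ n, 0 ≤ len n) (n : ℕ) :
    a (n + 1) ≤ dep c a len (n + 1) := by
  have h1 := le_max_left (a (n + 1)) (dep c a len n)
  have h2 := div_nonneg (hlen (n + 1)) hc.le
  simp only [dep]
  linarith

/-- Every packet departs when its busy period, started by the arrival of some packet `k`,
has served all packets from `k` on. -/
theorem exists_busy_period_start {c : ℝ} (hc : 0 < c) {a : ℕ → ℝ} (len : ℕ → ℝ)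
    (ha : 0 ≤ a 1) (n : ℕ) :
    ∃ k, 1 ≤ k ∧ k ≤ n + 1 ∧
      c * (dep c a len (n + 1) - a k) = ∑ i ∈ Finset.Ico k (n + 2), len i := by
  induction n with
  | zero =>
    refine ⟨1, le_rfl, le_rfl, ?_⟩
    simp only [dep, max_eq_left ha]
    simp
    field_simp
  | succ n ih =>
    rcases le_total (dep c a len (n + 1)) (a (n + 2)) with h | h
    · refine ⟨n + 2, by omega, le_rfl, ?_⟩
      rw [dep, max_eq_left h, Finset.sum_Ico_succ_top (by omega)]
      simp
      field_simp
    · obtain ⟨k, hk1, hkn, hk⟩ := ih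
      refine ⟨k, hk1, by omega, ?_⟩
      rw [dep, max_eq_right h, Finset.sum_Ico_succ_top (by omega), ← hk]
      field_simp
      ring

/-- The cumulative input up to the arrival of packet `k` counts only packets before `k`. -/
theorem tsum_arrivals_le {a len : ℕ → ℝ} (hamono : ∀ n, 1 ≤ n → a n ≤ a (n + 1))
    (hlen : ∀ n, 0 ≤ len n) {k : ℕ} (hk : 1 ≤ k) {s : ℝ} (hs : s ≤ a k) :
    (∑' n : ℕ, if a n < s then len n else 0) ≤ ∑ i ∈ Finset.range k, len i := by
  rw [tsum_eq_sum (s := Finset.range k)]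
  · refine Finset.sum_le_sum fun i _ => ?_
    split_ifs
    exacts [le_rfl, hlen i]
  · intro i hi
    have hki : k ≤ i := by simpa using hi
    have : a k ≤ a i := Nat.le_induction le_rfl
      (fun n hn h => h.trans (hamono n (hk.trans hn))) i hki
    exact if_neg (by linarith)

/-- A packetized work-conserving FIFO server of constant bit rate
`c` offers the service curve `β(t) = c·(t − l^M/c)⁺`, where `l^M` is the maximum
packet length: for all `t ≥ 0`,
`A*(t) ≥ inf_{0 ≤ s ≤ t} ( A(s) + c·max(t − s − l^M/c, 0) )`. -/
theorem corrected_service_curve_CBR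
    (c lM : ℝ) (hc : 0 < c)
    (a len : ℕ → ℝ)
    (ha1 : 0 ≤ a 1) (hamono : ∀ n, 1 ≤ n → a n ≤ a (n + 1))
    (hlen0 : len 0 = 0)
    (hlen : ∀ n, 1 ≤ n → 0 < len n ∧ len n ≤ lM)
    (A Astar : ℝ → ℝ)
    (hA : ∀ t, A t = ∑' n : ℕ, if a n < t then len n else 0)
    (hAstar : ∀ t, Astar t = ∑' n : ℕ, if dep c a len n < t then len n else 0) :
    ∀ t, 0 ≤ t →
      sInf ((fun s => A s + c * max (t - s - lM / c) 0) '' Set.Icc 0 t) ≤ Astar t := by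
  intro t ht
  have hlen' : ∀ n, 0 ≤ len n := by
    intro n
    rcases n.eq_zero_or_pos with rfl | hn
    · exact hlen0.ge
    · exact (hlen n hn).1.le
  have hlM : 0 < lM := (hlen 1 le_rfl).1.trans_le (hlen 1 le_rfl).2
  have hβ0 : max (t - t - lM / c) 0 = 0 := max_eq_right (by
    have := div_pos hlM hc
    linarith)
  suffices h : ∃ s ∈ Set.Icc 0 t, A s + c * max (t - s - lM / c) 0 ≤ Astar t by
    obtain ⟨s, hs, hle⟩ := h
    refine (csInf_le ⟨0, ?_⟩ (Set.mem_image_of_mem _ hs)).trans hle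
    rintro _ ⟨u, -, rfl⟩
    have hAu : 0 ≤ A u := by
      rw [hA]
      exact tsum_nonneg fun n => by split_ifs; exacts [hlen' n, le_rfl]
    positivity
  by_cases hex : ∃ n, t ≤ dep c a len (n + 1)
  · classical
    obtain ⟨n, hn, hmin⟩ : ∃ n, t ≤ dep c a len (n + 1) ∧ ∀ m < n, dep c a len (m + 1) < t :=
      ⟨Nat.find hex, Nat.find_spec hex, fun m hm => not_le.1 (Nat.find_min hex hm)⟩
    have hout : Astar t = ∑ i ∈ Finset.range (n + 1), len i := by
      rw [hAstar, tsum_eq_sum (s := Finset.range (n + 1))]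
      · refine Finset.sum_congr rfl fun i hi => ?_
        rcases i with _ | i
        · simp [hlen0]
        · exact if_pos (hmin i (by simpa using hi))
      · intro i hi
        have hni : n + 1 ≤ i := by simpa using hi
        exact if_neg (hn.trans (dep_monotone hc hlen' hni)).not_gt
    obtain ⟨k, hk1, hkn, hk⟩ := exists_busy_period_start hc len ha1 n
    have hsplit : ∑ i ∈ Finset.range k, len i + ∑ i ∈ Finset.Ico k (n + 1), len i = Astar t := by
      rw [hout, Finset.sum_range_add_sum_Ico _ hkn]
    have hIco : 0 ≤ ∑ i ∈ Finset.Ico k (n + 1), len i := Finset.sum_nonneg fun i _ => hlen' i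
    rcases le_or_gt t (a k) with hta | hta
    · refine ⟨t, ⟨ht, le_rfl⟩, ?_⟩
      have := tsum_arrivals_le hamono hlen' hk1 hta
      rw [hβ0, hA]
      linarith
    · have hak : 0 ≤ a k := Nat.le_induction ha1
        (fun n hn h => h.trans (hamono n hn)) k hk1
      refine ⟨a k, ⟨hak, hta.le⟩, ?_⟩
      have hin := tsum_arrivals_le hamono hlen' hk1 (le_refl (a k))
      rw [← hA] at hin
      have hβ : c * max (t - a k - lM / c) 0 ≤ ∑ i ∈ Finset.Ico k (n + 1), len i := by
        rw [mul_max_of_nonneg _ _ hc.le, mul_zero]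
        refine max_le ?_ hIco
        rw [Finset.sum_Ico_succ_top hkn] at hk
        have h1 : c * (t - a k) ≤ c * (dep c a len (n + 1) - a k) := by gcongr
        have h2 := (hlen (n + 1) (by omega)).2
        rw [mul_sub, mul_div_cancel₀ _ hc.ne']
        linarith
      linarith
  · push Not at hex
    refine ⟨t, ⟨ht, le_rfl⟩, le_of_eq ?_⟩
    rw [hβ0, mul_zero, add_zero, hA, hAstar]
    refine tsum_congr fun n => ?_
    rcases n with _ | n
    · simp [hlen0]
    · rw [if_pos (hex n), if_pos ((arrival_le_dep hc hlen' n).trans_lt (hex n))]
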